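/- Let β = (√17 − 3)/2 and define h : [0,1] → ℝ by h(u) = (u(1−u))^{β/2}. Then for every x ∈ [0,1], ∫₀¹∫₀¹ [ 𝟙_{x < u} ((uv)^β + (u(1−v))^β) h(x/u) + 𝟙_{u < x} (((1−u)v)^β + ((1−u)(1−v))^β) h((x−u)/(1−u)) ] du dv = h(x). (This is the verification that the pair (β, h) satisfies the Malthusian hypothesis for the quadtree dislocation measure; equivalently it expresses that the expected one-step value of the quadtree partial-match martingale weight equals h(x).) -/

import Mathlib

open MeasureTheory Real

/-- The exponent `β = (√17 − 3)/2` of partial match queries in quadtrees. -/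
noncomputable def quadBeta : ℝ := (Real.sqrt 17 - 3) / 2

/-- The function `h(u) = (u(1−u))^{β/2}`. -/
noncomputable def quadH (u : ℝ) : ℝ := (u * (1 - u)) ^ (quadBeta / 2)

theorem quadBeta_pos : 0 < quadBeta := by
  have h : (3 : ℝ) < √17 := Real.lt_sqrt_of_sq_lt (by norm_num)
  unfold quadBeta
  linarith

theorem quadBeta_add_one_mul_add_two : (quadBeta + 1) * (quadBeta + 2) = 4 := by
  have h : √17 ^ 2 = 17 := Real.sq_sqrt (by norm_num)
  unfold quadBeta
  linear_combination h / 4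

theorem rpow_mul_div_mul_div_rpow_half {c a b s : ℝ} (hc : 0 < c) (ha : 0 ≤ a) (hb : 0 ≤ b) :
    c ^ s * (a / c * (b / c)) ^ (s / 2) = a ^ (s / 2) * b ^ (s / 2) := by
  have hs : c ^ s = c ^ (s / 2) * c ^ (s / 2) := by
    rw [← Real.rpow_add hc, add_halves]
  have hpos := Real.rpow_pos_of_pos hc (s / 2)
  rw [Real.mul_rpow (by positivity) (by positivity), Real.div_rpow ha hc.le,
    Real.div_rpow hb hc.le, hs]
  field_simp

theorem integral_rpow_mul_add_rpow_mul_one_sub {c s : ℝ} (hc : 0 ≤ c) (hs : 0 < s) (k : ℝ) :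
    ∫ v in (0 : ℝ)..1, ((c * v) ^ s + (c * (1 - v)) ^ s) * k = 2 / (s + 1) * (c ^ s * k) := by
  have hcont : Continuous fun v : ℝ => v ^ s := Real.continuous_rpow_const hs.le
  have hcont' : Continuous fun v : ℝ => (1 - v) ^ s :=
    hcont.comp (continuous_const.sub continuous_id)
  have hint : ∫ v in (0 : ℝ)..1, v ^ s = 1 / (s + 1) := by
    rw [integral_rpow (Or.inl (by linarith)), Real.one_rpow, Real.zero_rpow (by linarith), sub_zero]
  have hint' : ∫ v in (0 : ℝ)..1, (1 - v) ^ s = 1 / (s + 1) := by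
    rw [intervalIntegral.integral_comp_sub_left (fun v : ℝ => v ^ s) 1, sub_self, sub_zero, hint]
  calc ∫ v in (0 : ℝ)..1, ((c * v) ^ s + (c * (1 - v)) ^ s) * k
      = ∫ v in (0 : ℝ)..1, c ^ s * k * (v ^ s + (1 - v) ^ s) := by
        refine intervalIntegral.integral_congr fun v hv => ?_
        rw [Set.uIcc_of_le zero_le_one] at hv
        rw [Real.mul_rpow hc hv.1, Real.mul_rpow hc (sub_nonneg.2 hv.2)]
        ring
    _ = 2 / (s + 1) * (c ^ s * k) := by
        rw [intervalIntegral.integral_const_mul, intervalIntegral.integral_add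
          (hcont.intervalIntegrable _ _)
          (hcont'.intervalIntegrable _ _), hint, hint']
        ring

/-- The pair `(β, h)` satisfies the Malthusian hypothesis for the quadtree
dislocation measure. -/
theorem quadtree_malthusian (x : ℝ) (hx : x ∈ Set.Icc (0 : ℝ) 1) :
    (∫ u in (0 : ℝ)..1, ∫ v in (0 : ℝ)..1,
      ((if x < u then ((u * v) ^ quadBeta + (u * (1 - v)) ^ quadBeta) * quadH (x / u) else 0)
        + (if u < x then
            (((1 - u) * v) ^ quadBeta + ((1 - u) * (1 - v)) ^ quadBeta)
              * quadH ((x - u) / (1 - u))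
          else 0)))
      = quadH x := by
  have hβ := quadBeta_pos
  obtain ⟨hx0, hx1⟩ := hx
  have hzero : (0 : ℝ) ^ (quadBeta / 2) = 0 := Real.zero_rpow (by linarith)
  have hcont : Continuous fun v : ℝ => v ^ (quadBeta / 2) :=
    Real.continuous_rpow_const (by linarith)
  have hpow (a : ℝ) (ha : 0 ≤ a) :
      ∫ v in (0 : ℝ)..a, v ^ (quadBeta / 2) = a ^ (quadBeta / 2) * a / (quadBeta / 2 + 1) := by
    rw [integral_rpow (Or.inl (by linarith)), Real.zero_rpow (by linarith), sub_zero,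
      Real.rpow_add_one' ha (by linarith)]
  set F : ℝ → ℝ := fun u => ∫ v in (0 : ℝ)..1,
      ((if x < u then ((u * v) ^ quadBeta + (u * (1 - v)) ^ quadBeta) * quadH (x / u) else 0)
        + (if u < x then
            (((1 - u) * v) ^ quadBeta + ((1 - u) * (1 - v)) ^ quadBeta)
              * quadH ((x - u) / (1 - u))
          else 0)) with hF
  have hleft : Set.EqOn F (fun u => 2 / (quadBeta + 1) * (1 - x) ^ (quadBeta / 2) *
      (x - u) ^ (quadBeta / 2)) (Set.uIcc 0 x) := by
    intro u hu
    rw [Set.uIcc_of_le hx0] at hu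
    rcases hu.2.eq_or_lt with rfl | hlt
    · simp [hF, hzero]
    · have hu1 : 0 < 1 - u := by linarith
      have hsub : 1 - (x - u) / (1 - u) = (1 - x) / (1 - u) := by field_simp; ring
      simp only [hF, if_pos hlt, if_neg hlt.not_gt, zero_add]
      rw [integral_rpow_mul_add_rpow_mul_one_sub hu1.le hβ, quadH, hsub,
        rpow_mul_div_mul_div_rpow_half hu1 (by linarith) (by linarith)]
      ring
  have hright : Set.EqOn F (fun u => 2 / (quadBeta + 1) * x ^ (quadBeta / 2) *
      (u - x) ^ (quadBeta / 2)) (Set.uIcc x 1) := by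
    intro u hu
    rw [Set.uIcc_of_le hx1] at hu
    rcases hu.1.eq_or_lt with rfl | hlt
    · simp [hF, hzero]
    · have hu0 : 0 < u := by linarith
      have hsub : 1 - x / u = (u - x) / u := by field_simp
      simp only [hF, if_pos hlt, if_neg hlt.not_gt, add_zero]
      rw [integral_rpow_mul_add_rpow_mul_one_sub hu0.le hβ, quadH, hsub,
        rpow_mul_div_mul_div_rpow_half hu0 hx0 (by linarith)]
      ring
  have hintl : IntervalIntegrable F volume 0 x :=
    ((continuous_const.mul (hcont.comp (continuous_const.sub continuous_id))).intervalIntegrable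
      0 x).congr (hleft.symm.mono Set.uIoc_subset_uIcc)
  have hintr : IntervalIntegrable F volume x 1 :=
    ((continuous_const.mul (hcont.comp (continuous_id.sub continuous_const))).intervalIntegrable
      x 1).congr (hright.symm.mono Set.uIoc_subset_uIcc)
  rw [← intervalIntegral.integral_add_adjacent_intervals hintl hintr,
    intervalIntegral.integral_congr hleft, intervalIntegral.integral_congr hright,
    intervalIntegral.integral_const_mul, intervalIntegral.integral_const_mul,
    intervalIntegral.integral_comp_sub_left (fun v : ℝ => v ^ (quadBeta / 2)) x,
    intervalIntegral.integral_comp_sub_right (fun v : ℝ => v ^ (quadBeta / 2)) x,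
    sub_self, sub_zero, hpow x hx0, hpow (1 - x) (by linarith), quadH,
    Real.mul_rpow hx0 (by linarith)]
  have h1 : quadBeta + 1 ≠ 0 := by linarith
  have h2 : quadBeta + 2 ≠ 0 := by linarith
  field_simp
  linear_combination
    -(x ^ (quadBeta / 2) * (1 - x) ^ (quadBeta / 2)) * quadBeta_add_one_mul_add_two
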